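/- arXiv:2407.12986 — 3 statements merged into one kernel-verified Lean document; each statement's English description precedes it below -/
import Mathlib

section
/- Let δ, δ̃ be real numbers with δ̃ ≠ 0 and 8δ̃ + 1 ≠ 0, and define g₂(c) = ((26δ̃³ + 16δ̃²δ + 32δ̃δ² + 3δ̃²)·c³ + (16δ² − 16δ̃δ − 16δ̃² + 2δ̃)·c²) / ((128δ̃² + 16δ̃)·c² + (8 − 80δ̃)·c). Then, as c → ∞, the difference g₂(c) − ((32δ² + 16δ̃δ + 26δ̃² + 3δ̃)/(16(8δ̃+1)))·c converges to (2δ̃ − 24δ + 1)² / (32(8δ̃+1)²). -/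
open Filter

/-- Large-`c` expansion of the second logarithmic block coefficient for heavy
operators (`α = 1`): the difference between `g₂(c)` and its leading linear term
converges to the constant subleading term. -/
theorem g2_heavy_subleading (δ δt : ℝ) (hδt : δt ≠ 0) (h8 : 8 * δt + 1 ≠ 0) :
    Tendsto (fun c : ℝ =>
        ((26 * δt ^ 3 + 16 * δt ^ 2 * δ + 32 * δt * δ ^ 2 + 3 * δt ^ 2) * c ^ 3
            + (16 * δ ^ 2 - 16 * δt * δ - 16 * δt ^ 2 + 2 * δt) * c ^ 2) /
          ((128 * δt ^ 2 + 16 * δt) * c ^ 2 + (8 - 80 * δt) * c)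
        - ((32 * δ ^ 2 + 16 * δt * δ + 26 * δt ^ 2 + 3 * δt) / (16 * (8 * δt + 1))) * c)
      atTop (nhds ((2 * δt - 24 * δ + 1) ^ 2 / (32 * (8 * δt + 1) ^ 2))) := by
  have ha : (128 * δt ^ 2 + 16 * δt) ≠ 0 := by
    have : 128 * δt ^ 2 + 16 * δt = 16 * δt * (8 * δt + 1) := by ring
    rw [this]
    exact mul_ne_zero (mul_ne_zero (by norm_num) hδt) h8
  have hden : Tendsto (fun c : ℝ => (128 * δt ^ 2 + 16 * δt) + (8 - 80 * δt) * c⁻¹) atTop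
      (nhds (128 * δt ^ 2 + 16 * δt)) := by
    simpa using (tendsto_inv_atTop_zero.const_mul (8 - 80 * δt)).const_add
      (128 * δt ^ 2 + 16 * δt)
  have hlim := (tendsto_const_nhds (x := (2 * δt - 24 * δ + 1) ^ 2 / (32 * (8 * δt + 1) ^ 2)
      * (128 * δt ^ 2 + 16 * δt))).div hden ha
  rw [mul_div_cancel_right₀ _ ha] at hlim
  refine hlim.congr' ?_
  filter_upwards [hden.eventually_ne ha, eventually_gt_atTop 0] with c hc hc0
  have hc0' : c ≠ 0 := hc0.ne'
  have hd : (128 * δt ^ 2 + 16 * δt) * c ^ 2 + (8 - 80 * δt) * c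
      = c ^ 2 * ((128 * δt ^ 2 + 16 * δt) + (8 - 80 * δt) * c⁻¹) := by
    field_simp
  rw [hd]
  generalize hD : (128 * δt ^ 2 + 16 * δt) + (8 - 80 * δt) * c⁻¹ = D at hc
  have hD' : (8 - 80 * δt) = (D - (128 * δt ^ 2 + 16 * δt)) * c := by
    rw [← hD]; field_simp; ring
  simp only [Pi.div_apply, hD]
  generalize hs : 8 * δt + 1 = s at h8 ⊢
  field_simp
  subst hs
  linear_combination (-(32 * (8 * δt + 1) * (32 * δ ^ 2 + 16 * δt * δ + 26 * δt ^ 2 + 3 * δt))) * hD'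
end

section
/- For elements z₁, z₂, z₃ of a commutative ring, the determinant of the 5×5 matrix with rows (0, 0, 1, 1, 1), (1, 1, z₁, z₂, z₃), (2z₁, 2z₂, z₁², z₂², z₃²), (3z₁², 3z₂², z₁³, z₂³, z₃³), (4z₁³, 4z₂³, z₁⁴, z₂⁴, z₃⁴) equals −(z₁−z₂)⁴·(z₁−z₃)²·(z₂−z₃)². -/
/-- Determinant of the Ward-identity system with one semi-degenerate operator. -/
theorem ward_det_one_semidegenerate {R : Type*} [CommRing R] (z₁ z₂ z₃ : R) :
    Matrix.det
      !![0, 0, 1, 1, 1;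
         1, 1, z₁, z₂, z₃;
         2 * z₁, 2 * z₂, z₁ ^ 2, z₂ ^ 2, z₃ ^ 2;
         3 * z₁ ^ 2, 3 * z₂ ^ 2, z₁ ^ 3, z₂ ^ 3, z₃ ^ 3;
         4 * z₁ ^ 3, 4 * z₂ ^ 3, z₁ ^ 4, z₂ ^ 4, z₃ ^ 4]
      = -((z₁ - z₂) ^ 4 * (z₁ - z₃) ^ 2 * (z₂ - z₃) ^ 2) := by
  simp [Matrix.det_succ_row_zero, Fin.sum_univ_succ, Fin.succAbove]
  ring
end

section
/- Let z₁, z₂, z₃ be pairwise distinct real numbers and h₁, h₂, h₃, w₁, w₂, w₃ real numbers with h₂ ≠ 0 and h₃ ≠ 0. Set ℓ₂ = −((h₂+h₁−h₃)/(z₂−z₁) + (h₂+h₃−h₁)/(z₂−z₃)) and ℓ₃ = −((h₃+h₁−h₂)/(z₃−z₁) + (h₃+h₂−h₁)/(z₃−z₂)). Then the determinant of the 5×5 matrix with rows ((0, 0, 1, 1, 1)), (((3w₂/(2h₂))ℓ₂ + (3w₃/(2h₃))ℓ₃, 1, z₁, z₂, z₃)), (((3w₂/h₂)z₂ℓ₂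 + (3w₃/h₃)z₃ℓ₃ + w₁+w₂+w₃, 2z₁, z₁², z₂², z₃²)), (((9w₂/(2h₂))z₂²ℓ₂ + (9w₃/(2h₃))z₃²ℓ₃ + 3(w₁z₁+w₂z₂+w₃z₃), 3z₁², z₁³, z₂³, z₃³)), (((6w₂/h₂)z₂³ℓ₂ + (6w₃/h₃)z₃³ℓ₃ + 6(w₁z₁²+w₂z₂²+w₃z₃²), 4z₁³, z₂³·z₁, z₂⁴, z₃⁴)) — where the last row is ((6w₂/h₂)z₂³ℓ₂ + (6w₃/h₃)z₃³ℓ₃ + 6(w₁z₁²+w₂z₂²+w₃z₃²), 4z₁³, z₁⁴, z₂⁴, z₃⁴) — equals ((2h₂h₃w₁ − h₃(−3h₁+h₂+3h₃)w₂ − h₂(−3h₁+3h₂+h₃)w₃)/(2h₂h₃)) · (z₁−z₂)³·(z₁−z₃)³·(z₂−z₃). -/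
/-- Expansion of the determinant along its first column; the coefficients are those of
`(X - x)² (X - y) (X - z)`. -/
theorem ward_det_aux (x y z a b c d : ℝ) :
    Matrix.det
      !![0, 0, 1, 1, 1;
         a, 1, x, y, z;
         b, 2 * x, x ^ 2, y ^ 2, z ^ 2;
         c, 3 * x ^ 2, x ^ 3, y ^ 3, z ^ 3;
         d, 4 * x ^ 3, x ^ 4, y ^ 4, z ^ 4]
      = (x - y) ^ 2 * (x - z) ^ 2 * (y - z) *
        (d - (2 * x + y + z) * c + (x ^ 2 + 2 * x * (y + z) + y * z) * b
          - (x ^ 2 * (y + z) + 2 * x * y * z) * a) := by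
  simp [Matrix.det_succ_row_zero, Fin.sum_univ_succ, Fin.succAbove]
  ring

/-- Determinant of the Ward-identity system with two semi-degenerate operators;
its vanishing yields the `W₃` fusion rule. -/
theorem ward_det_two_semidegenerate (z₁ z₂ z₃ h₁ h₂ h₃ w₁ w₂ w₃ : ℝ)
    (h12 : z₁ ≠ z₂) (h13 : z₁ ≠ z₃) (h23 : z₂ ≠ z₃)
    (hh₂ : h₂ ≠ 0) (hh₃ : h₃ ≠ 0)
    (ℓ₂ ℓ₃ : ℝ)
    (hℓ₂ : ℓ₂ = -((h₂ + h₁ - h₃) / (z₂ - z₁) + (h₂ + h₃ - h₁) / (z₂ - z₃)))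
    (hℓ₃ : ℓ₃ = -((h₃ + h₁ - h₂) / (z₃ - z₁) + (h₃ + h₂ - h₁) / (z₃ - z₂))) :
    Matrix.det
      !![0, 0, 1, 1, 1;
         (3 * w₂ / (2 * h₂)) * ℓ₂ + (3 * w₃ / (2 * h₃)) * ℓ₃, 1, z₁, z₂, z₃;
         (3 * w₂ / h₂) * z₂ * ℓ₂ + (3 * w₃ / h₃) * z₃ * ℓ₃ + w₁ + w₂ + w₃,
           2 * z₁, z₁ ^ 2, z₂ ^ 2, z₃ ^ 2;
         (9 * w₂ / (2 * h₂)) * z₂ ^ 2 * ℓ₂ + (9 * w₃ / (2 * h₃)) * z₃ ^ 2 * ℓ₃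
             + 3 * (w₁ * z₁ + w₂ * z₂ + w₃ * z₃),
           3 * z₁ ^ 2, z₁ ^ 3, z₂ ^ 3, z₃ ^ 3;
         (6 * w₂ / h₂) * z₂ ^ 3 * ℓ₂ + (6 * w₃ / h₃) * z₃ ^ 3 * ℓ₃
             + 6 * (w₁ * z₁ ^ 2 + w₂ * z₂ ^ 2 + w₃ * z₃ ^ 2),
           4 * z₁ ^ 3, z₁ ^ 4, z₂ ^ 4, z₃ ^ 4]
      = ((2 * h₂ * h₃ * w₁ - h₃ * (-3 * h₁ + h₂ + 3 * h₃) * w₂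
            - h₂ * (-3 * h₁ + 3 * h₂ + h₃) * w₃) / (2 * h₂ * h₃))
          * (z₁ - z₂) ^ 3 * (z₁ - z₃) ^ 3 * (z₂ - z₃) := by
  have e12 : z₂ - z₁ ≠ 0 := sub_ne_zero.mpr h12.symm
  have e13 : z₃ - z₁ ≠ 0 := sub_ne_zero.mpr h13.symm
  have e23 : z₂ - z₃ ≠ 0 := sub_ne_zero.mpr h23
  have e32 : z₃ - z₂ ≠ 0 := sub_ne_zero.mpr h23.symm
  have k₂ : ℓ₂ * ((z₂ - z₁) * (z₂ - z₃))
      = -((h₂ + h₁ - h₃) * (z₂ - z₃) + (h₂ + h₃ - h₁) * (z₂ - z₁)) := by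
    rw [hℓ₂]; field_simp
  have k₃ : ℓ₃ * ((z₃ - z₁) * (z₃ - z₂))
      = -((h₃ + h₁ - h₂) * (z₃ - z₂) + (h₃ + h₂ - h₁) * (z₃ - z₁)) := by
    rw [hℓ₃]; field_simp
  clear hℓ₂ hℓ₃
  rw [ward_det_aux]
  obtain ⟨p, rfl⟩ : ∃ p, w₂ = p * h₂ := ⟨w₂ / h₂, by field_simp⟩
  obtain ⟨q, rfl⟩ : ∃ q, w₃ = q * h₃ := ⟨w₃ / h₃, by field_simp⟩
  have a₂ : 3 * (p * h₂) / (2 * h₂) = 3 / 2 * p := by field_simp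
  have a₃ : 3 * (q * h₃) / (2 * h₃) = 3 / 2 * q := by field_simp
  have b₂ : 3 * (p * h₂) / h₂ = 3 * p := by field_simp
  have b₃ : 3 * (q * h₃) / h₃ = 3 * q := by field_simp
  have c₂ : 9 * (p * h₂) / (2 * h₂) = 9 / 2 * p := by field_simp
  have c₃ : 9 * (q * h₃) / (2 * h₃) = 9 / 2 * q := by field_simp
  have d₂ : 6 * (p * h₂) / h₂ = 6 * p := by field_simp
  have d₃ : 6 * (q * h₃) / h₃ = 6 * q := by field_simp
  have r : (2 * h₂ * h₃ * w₁ - h₃ * (-3 * h₁ + h₂ + 3 * h₃) * (p * h₂)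
      - h₂ * (-3 * h₁ + 3 * h₂ + h₃) * (q * h₃)) / (2 * h₂ * h₃)
      = w₁ - (-3 * h₁ + h₂ + 3 * h₃) * p / 2 - (-3 * h₁ + 3 * h₂ + h₃) * q / 2 := by
    field_simp
  rw [a₂, a₃, b₂, b₃, c₂, c₃, d₂, d₃, r]
  linear_combination
    (z₁ - z₂) ^ 2 * (z₁ - z₃) ^ 2 * (z₂ - z₃) * (3 / 2) * p * (z₂ - z₁) * k₂
    + (z₁ - z₂) ^ 2 * (z₁ - z₃) ^ 2 * (z₂ - z₃) * (3 / 2) * q * (z₃ - z₁) * k₃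
end
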